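/- arXiv:2605.29962 — 3 statements merged into one kernel-verified Lean document; each statement's English description precedes it below -/
import Mathlib

section
/- Let N ≥ 1 be an integer, M ≥ 1, and let λ₁, …, λ_M be real numbers. Let η₁ > 0 satisfy N·η₁ < 2^{−1/2}, and suppose that at least two indices i ∈ {1,…,M} satisfy |λ_i| ≤ η₁. Then for every η with 0 < η < η₁: (1/4)·∑_{i=1}^M log(λ_i² + η²) ≤ log(N·η₁) + 1 + (1/4)·∑_{i=1}^M log(λ_i² + N^{−2}). -/
/-- A shift `s` below `t` only lowers `log (x + ·)`. -/
lemma log_add_sub_log_add_nonneg {x s t : ℝ} (hx : 0 ≤ x) (hs : 0 < s) (hst : s ≤ t) :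
    0 ≤ Real.log (x + t) - Real.log (x + s) :=
  sub_nonneg.2 (Real.log_le_log (by positivity) (by gcongr))

/-- If `|x| ≤ r` and `η ≤ r`, replacing the scale `η` by `c⁻¹` raises the logarithm by at least
`-(log 2 + 2 log (c r))`. -/
lemma neg_log_two_add_le_log_sub_log {x r η c : ℝ} (hx : |x| ≤ r) (hη : 0 < η) (hηr : η ≤ r)
    (hc : 0 < c) :
    -(Real.log 2 + 2 * Real.log (c * r))
      ≤ Real.log (x ^ 2 + (c ^ 2)⁻¹) - Real.log (x ^ 2 + η ^ 2) := by
  have hr : 0 < r := hη.trans_le hηr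
  have hx2 : x ^ 2 ≤ r ^ 2 := sq_le_sq' (abs_le.1 hx).1 (abs_le.1 hx).2
  have hη2 : η ^ 2 ≤ r ^ 2 := by gcongr
  have upper : Real.log (x ^ 2 + η ^ 2) ≤ Real.log (2 * r ^ 2) :=
    Real.log_le_log (by positivity) (by linarith)
  have lower : Real.log (c ^ 2)⁻¹ ≤ Real.log (x ^ 2 + (c ^ 2)⁻¹) :=
    Real.log_le_log (by positivity) (by linarith [sq_nonneg x])
  rw [Real.log_mul two_ne_zero (by positivity), Real.log_pow] at upper
  rw [Real.log_inv, Real.log_pow] at lower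
  rw [Real.log_mul hc.ne' hr.ne']
  push_cast at upper lower
  linarith


/-- **Deterministic regularization of the log-characteristic polynomial.**
If `N η₁ < 2^{−1/2}` and at least two of the `λ_i` lie in `[−η₁, η₁]`, then for every
`0 < η < η₁` one has
`(1/4) ∑ log(λ_i² + η²) ≤ log(N η₁) + 1 + (1/4) ∑ log(λ_i² + N^{−2})`. -/
theorem deterministic_regularization
    (N M : ℕ) (hN : 1 ≤ N) (hM : 1 ≤ M)
    (lam : Fin M → ℝ) (η₁ : ℝ) (hη₁ : 0 < η₁)
    (hsmall : (N : ℝ) * η₁ < (Real.sqrt 2)⁻¹)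
    (htwo : ∃ i j : Fin M, i ≠ j ∧ |lam i| ≤ η₁ ∧ |lam j| ≤ η₁) :
    ∀ η : ℝ, 0 < η → η < η₁ →
      (1/4) * ∑ i, Real.log (lam i ^ 2 + η ^ 2)
        ≤ Real.log ((N : ℝ) * η₁) + 1
            + (1/4) * ∑ i, Real.log (lam i ^ 2 + ((N : ℝ) ^ 2)⁻¹) := by
  intro η hη hηη₁
  obtain ⟨i, j, hij, hi, hj⟩ := htwo
  have hN0 : (0 : ℝ) < N := by exact_mod_cast hN
  have hη2 : η ^ 2 ≤ ((N : ℝ) ^ 2)⁻¹ := by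
    have h1 : (N : ℝ) * η ≤ 1 :=
      calc (N : ℝ) * η ≤ N * η₁ := by gcongr
        _ ≤ (Real.sqrt 2)⁻¹ := hsmall.le
        _ ≤ 1 := inv_le_one_of_one_le₀ (Real.one_le_sqrt.2 one_le_two)
    rw [← inv_pow]
    gcongr
    rwa [le_inv_comm₀ hη hN0, ← one_div, le_div_iff₀ hη]
  have hpair := Finset.sum_le_sum_of_subset_of_nonneg (Finset.subset_univ {i, j})
    fun k _ _ => log_add_sub_log_add_nonneg (sq_nonneg (lam k)) (pow_pos hη 2) hη2
  rw [Finset.sum_pair hij, Finset.sum_sub_distrib] at hpair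
  linarith [neg_log_two_add_le_log_sub_log hi hη hηη₁.le hN0,
    neg_log_two_add_le_log_sub_log hj hη hηη₁.le hN0, Real.log_two_lt_d9]
end

section
/- Let N ≥ 5 be an integer, n ≥ 1, and let μ₁, …, μ_n be nonnegative real numbers; for y > 0 set S(y) := ∑_{i=1}^n y/(μ_i² + y²). Then: (i) if min_i μ_i ≤ η for some η > 0, then η·S(η) ≥ 1/4; (ii) if η ∈ (0, 1/N] and μ_i > η for all i, then, setting η₁ := η/(log N)³ and η₂ := (log N)/N, one has η₁·S(η₁) ≤ S(η₂)/(N·(log N)³); (iii) if ν ∈ (0, N^{−1}(log N)^{−4}), S((log N)/N) ≤ N·log N, and ν·S(ν) ≥ 1/log N, then min_i μ_i ≤ (log N)³·ν. -/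
theorem one_add_log_sq_le_log_pow_four {N : ℕ} (hN : 5 ≤ N) :
    1 + Real.log N ^ 2 ≤ Real.log N ^ 4 ∧ 1 < Real.log N := by
  have hlog : (1.38 : ℝ) < Real.log N := by
    have h4 : Real.log 4 = 2 * Real.log 2 := by
      rw [show (4 : ℝ) = 2 ^ 2 by norm_num, Real.log_pow]
      norm_num
    have hle : Real.log 4 ≤ Real.log N :=
      Real.log_le_log (by norm_num) (by exact_mod_cast (by omega : 4 ≤ N))
    have := Real.log_two_gt_d9
    linarith
  have hsq : (1.9 : ℝ) ≤ Real.log N ^ 2 := by nlinarith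
  exact ⟨by nlinarith, by linarith⟩

theorem mul_poisson_le_of_lt {L M a x : ℝ} (hL : 0 < L) (hL4 : 1 + L ^ 2 ≤ L ^ 4) (hM : 0 < M)
    (ha : 0 < a) (haM : a * L ^ 3 * M ≤ 1) (hax : a * L ^ 3 < x) :
    a * (a / (x ^ 2 + a ^ 2)) ≤ L / M / (x ^ 2 + (L / M) ^ 2) / (M * L ^ 3) := by
  have hx : 0 < x := lt_trans (by positivity) hax
  have hrhs : L / M / (x ^ 2 + (L / M) ^ 2) / (M * L ^ 3) =
      1 / (L ^ 2 * (M ^ 2 * x ^ 2 + L ^ 2)) := by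
    field_simp
  rw [hrhs, ← mul_div_assoc, div_le_div_iff₀ (by positivity) (by positivity)]
  have h1 : (a * L ^ 3 * M) ^ 2 * x ^ 2 ≤ 1 * x ^ 2 :=
    mul_le_mul_of_nonneg_right (pow_le_one₀ (by positivity) haM) (by positivity)
  have h2 : (a * L ^ 3) ^ 2 * L ^ 2 ≤ x ^ 2 * L ^ 2 := by gcongr
  have h3 : (1 + L ^ 2) * x ^ 2 ≤ L ^ 4 * x ^ 2 := by gcongr
  have h4 : L ^ 4 * (a * a * (L ^ 2 * (M ^ 2 * x ^ 2 + L ^ 2))) ≤ L ^ 4 * x ^ 2 := by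
    linarith
  have h5 := le_of_mul_le_mul_left h4 (by positivity)
  nlinarith [sq_nonneg a]

theorem mul_sum_poisson_le_of_forall_lt {ι : Type*} [Fintype ι] {L M a : ℝ} {x : ι → ℝ}
    (hL : 0 < L) (hL4 : 1 + L ^ 2 ≤ L ^ 4) (hM : 0 < M) (ha : 0 < a) (haM : a * L ^ 3 * M ≤ 1)
    (hax : ∀ i, a * L ^ 3 < x i) :
    a * ∑ i, a / (x i ^ 2 + a ^ 2) ≤
      (∑ i, L / M / (x i ^ 2 + (L / M) ^ 2)) / (M * L ^ 3) := by
  rw [Finset.mul_sum, Finset.sum_div]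
  exact Finset.sum_le_sum fun i _ => mul_poisson_le_of_lt hL hL4 hM ha haM (hax i)

/-- **Deterministic dichotomy for small eigenvalues** via the regularized Stieltjes
transform `S(y) = ∑ᵢ y/(μᵢ² + y²)`:
(i) if some `μᵢ ≤ η` then `η·S(η) ≥ 1/4`;
(ii) if all `μᵢ > η` with `η ≤ 1/N`, then `η₁·S(η₁) ≤ S(η₂)/(N (log N)³)` for
`η₁ = η/(log N)³`, `η₂ = (log N)/N`;
(iii) if `S((log N)/N) ≤ N log N` and `ν·S(ν) ≥ 1/log N` for some
`ν < N⁻¹(log N)⁻⁴`, then some `μᵢ ≤ (log N)³ ν`. -/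
theorem small_eigenvalue_dichotomy
    (N n : ℕ) (hN : 5 ≤ N) (hn : 1 ≤ n)
    (μ : Fin n → ℝ) (hμ : ∀ i, 0 ≤ μ i) :
    (∀ η : ℝ, 0 < η → (∃ i, μ i ≤ η) →
      (1 : ℝ)/4 ≤ η * ∑ i, η / (μ i ^ 2 + η ^ 2)) ∧
    (∀ η : ℝ, 0 < η → η ≤ (N : ℝ)⁻¹ → (∀ i, η < μ i) →
      (η / (Real.log N) ^ 3) *
          ∑ i, (η / (Real.log N) ^ 3) / (μ i ^ 2 + (η / (Real.log N) ^ 3) ^ 2)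
        ≤ (∑ i, (Real.log N / N) / (μ i ^ 2 + (Real.log N / N) ^ 2))
            / ((N : ℝ) * (Real.log N) ^ 3)) ∧
    (∀ ν : ℝ, 0 < ν → ν < (N : ℝ)⁻¹ * ((Real.log N) ^ 4)⁻¹ →
      (∑ i, (Real.log N / N) / (μ i ^ 2 + (Real.log N / N) ^ 2)) ≤ (N : ℝ) * Real.log N →
      (Real.log N)⁻¹ ≤ ν * ∑ i, ν / (μ i ^ 2 + ν ^ 2) →
      ∃ i, μ i ≤ (Real.log N) ^ 3 * ν) := by
  obtain ⟨hL4, hL1⟩ := one_add_log_sq_le_log_pow_four hN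
  have hM : (0 : ℝ) < N := by exact_mod_cast (by omega : 0 < N)
  generalize Real.log N = L at *
  generalize (N : ℝ) = M at *
  have hL : 0 < L := by linarith
  refine ⟨?_, ?_, ?_⟩
  · rintro η hη ⟨i, hi⟩
    have hterm : 1 / 4 ≤ η * (η / (μ i ^ 2 + η ^ 2)) := by
      have := pow_le_pow_left₀ (hμ i) hi 2
      rw [← mul_div_assoc, div_le_div_iff₀ (by norm_num) (by positivity)]
      nlinarith
    refine hterm.trans (mul_le_mul_of_nonneg_left ?_ hη.le)
    exact Finset.single_le_sum (f := fun j => η / (μ j ^ 2 + η ^ 2))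
      (fun j _ => by positivity) (Finset.mem_univ i)
  · intro η hη hηM hlt
    have ha : η / L ^ 3 * L ^ 3 = η := by field_simp
    refine mul_sum_poisson_le_of_forall_lt hL hL4 hM (by positivity) ?_ (by rwa [ha])
    rw [ha]
    exact (le_inv_mul_iff₀' hM).mp (by simpa using hηM)
  · intro ν hν hνM hS hlow
    by_contra! hlt
    have haM : ν * L ^ 3 * M ≤ 1 := by
      rw [← mul_inv, ← one_div, lt_div_iff₀ (by positivity)] at hνM
      have : ν * L ^ 3 * M * 1 ≤ ν * L ^ 3 * M * L := by gcongr
      linarith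
    have hup := mul_sum_poisson_le_of_forall_lt hL hL4 hM hν haM
      fun i => by simpa only [mul_comm] using hlt i
    have hS' : (∑ i, L / M / (μ i ^ 2 + (L / M) ^ 2)) / (M * L ^ 3) ≤ M * L / (M * L ^ 3) := by
      gcongr
    have h2 : M * L / (M * L ^ 3) = L⁻¹ * L⁻¹ := by field_simp
    have h3 : L⁻¹ * L⁻¹ < L⁻¹ * 1 :=
      mul_lt_mul_of_pos_left (inv_lt_one_of_one_lt₀ hL1) (by positivity)
    linarith
end

section
/- For every δ ∈ (0,1) there exists N₀ ∈ ℕ such that the following holds for all integers N ≥ N₀. Set η := N^{−1−δ}. Let n ≥ 1, let μ₁, …, μ_n be nonnegative real numbers, and for y > 0 set S(y) := ∑_{i=1}^n y/(μ_i² + y²). Let f : ℝ → [0,1] satisfy f(x) = 0 for all x < 1/20 and f(x) = 1 for all x > 1/10. Then 𝟙{min_i μ_i ≤ η} ≤ f(η·S(η)) ≤ 𝟙{min_i μ_i ≤ (log N)³·η} + 𝟙{S((log N)/N) > N·log N}. -/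
open scoped Classical

/-- At distance more than `K * η` from the origin, a Poisson-type kernel at scale `η` is controlled
by the one at scale `y`. -/
lemma mul_div_sq_add_sq_le {η y K m : ℝ} (hη : 0 < η) (hy : 0 < y) (hK : 0 < K)
    (hm : K * η < m) :
    η * (η / (m ^ 2 + η ^ 2)) ≤
      ((η / y) ^ 2 + 1 / K ^ 2) * (y * (y / (m ^ 2 + y ^ 2))) := by
  have hsq : (K * η) ^ 2 ≤ m ^ 2 := pow_le_pow_left₀ (by positivity) hm.le 2
  have hrhs : ((η / y) ^ 2 + 1 / K ^ 2) * (y * (y / (m ^ 2 + y ^ 2))) =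
      (K ^ 2 * η ^ 2 + y ^ 2) / (K ^ 2 * (m ^ 2 + y ^ 2)) := by
    field_simp
  have hlhs : η * (η / (m ^ 2 + η ^ 2)) = η ^ 2 / (m ^ 2 + η ^ 2) := by ring
  rw [hrhs, hlhs, div_le_div_iff₀ (by positivity) (by positivity)]
  nlinarith [mul_le_mul_of_nonneg_right hsq (sq_nonneg y),
    mul_nonneg (sq_nonneg (K * η)) (sq_nonneg η), mul_nonneg (sq_nonneg y) (sq_nonneg η)]

/-- If all `μ i` exceed `K * η`, the sum at scale `η` is controlled by the one at scale `y`. -/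
lemma mul_sum_div_sq_add_sq_le {ι : Type*} [Fintype ι] {μ : ι → ℝ} {η y K : ℝ}
    (hη : 0 < η) (hy : 0 < y) (hK : 0 < K) (hμ : ∀ i, K * η < μ i) :
    η * ∑ i, η / (μ i ^ 2 + η ^ 2) ≤
      ((η / y) ^ 2 + 1 / K ^ 2) * (y * ∑ i, y / (μ i ^ 2 + y ^ 2)) := by
  simp only [Finset.mul_sum]
  exact Finset.sum_le_sum fun i _ => mul_div_sq_add_sq_le hη hy hK (hμ i)

/-- If some `μ i` is at most `η`, then `η S(η)` is at least `1 / 2`. -/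
lemma half_le_mul_sum_div_sq_add_sq {ι : Type*} [Fintype ι] {μ : ι → ℝ} {η : ℝ}
    (hη : 0 < η) {i : ι} (h0 : 0 ≤ μ i) (hi : μ i ≤ η) :
    1 / 2 ≤ η * ∑ j, η / (μ j ^ 2 + η ^ 2) := by
  have hsq : μ i ^ 2 ≤ η ^ 2 := pow_le_pow_left₀ h0 hi 2
  calc 1 / 2 ≤ η * (η / (μ i ^ 2 + η ^ 2)) := by
        rw [← mul_div_assoc, div_le_div_iff₀ (by positivity) (by positivity)]
        nlinarith
    _ ≤ η * ∑ j, η / (μ j ^ 2 + η ^ 2) := by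
        gcongr
        exact Finset.single_le_sum (f := fun j => η / (μ j ^ 2 + η ^ 2))
          (fun j _ => by positivity) (Finset.mem_univ i)

/-- **Smoothed indicator of a small eigenvalue.**
For `η = N^{−1−δ}` with `N` large, any cutoff `f` with `f = 0` on `(−∞, 1/20)` and
`f = 1` on `(1/10, ∞)` satisfies
`𝟙{minᵢ μᵢ ≤ η} ≤ f(η S(η)) ≤ 𝟙{minᵢ μᵢ ≤ (log N)³ η} + 𝟙{S((log N)/N) > N log N}`,
where `S(y) = ∑ᵢ y/(μᵢ² + y²)`. -/
theorem smoothed_small_eigenvalue_indicator (δ : ℝ) (hδ0 : 0 < δ) (hδ1 : δ < 1) :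
    ∃ N₀ : ℕ, ∀ N : ℕ, N₀ ≤ N →
      ∀ n : ℕ, 1 ≤ n → ∀ μ : Fin n → ℝ, (∀ i, 0 ≤ μ i) →
      ∀ f : ℝ → ℝ, (∀ x, 0 ≤ f x ∧ f x ≤ 1) →
        (∀ x : ℝ, x < 1/20 → f x = 0) → (∀ x : ℝ, 1/10 < x → f x = 1) →
        ((if ∃ i, μ i ≤ (N : ℝ) ^ (-1 - δ) then (1:ℝ) else 0)
            ≤ f ((N : ℝ) ^ (-1 - δ) *
                ∑ i, (N : ℝ) ^ (-1 - δ) / (μ i ^ 2 + ((N : ℝ) ^ (-1 - δ)) ^ 2))) ∧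
          (f ((N : ℝ) ^ (-1 - δ) *
                ∑ i, (N : ℝ) ^ (-1 - δ) / (μ i ^ 2 + ((N : ℝ) ^ (-1 - δ)) ^ 2))
            ≤ (if ∃ i, μ i ≤ (Real.log N) ^ 3 * (N : ℝ) ^ (-1 - δ) then (1:ℝ) else 0)
              + (if (N : ℝ) * Real.log N <
                    ∑ i, (Real.log N / N) / (μ i ^ 2 + (Real.log N / N) ^ 2)
                  then (1:ℝ) else 0)) := by
  have hlog : ∀ᶠ N : ℕ in Filter.atTop, 3 ≤ Real.log N :=
    (Real.tendsto_log_atTop.comp tendsto_natCast_atTop_atTop).eventually_ge_atTop 3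
  have hrpow : ∀ᶠ N : ℕ in Filter.atTop, (N : ℝ) ^ (-δ) < 1 / 10 :=
    ((tendsto_rpow_neg_atTop hδ0).comp tendsto_natCast_atTop_atTop).eventually_lt_const
      (by norm_num)
  obtain ⟨N₀, hN₀⟩ := Filter.eventually_atTop.1
    (hlog.and (hrpow.and (Filter.eventually_gt_atTop 0)))
  refine ⟨N₀, fun N hN n _ μ hμ f hf hf0 hf1 => ?_⟩
  obtain ⟨hL, hε, hNpos⟩ := hN₀ N hN
  have hN' : (0 : ℝ) < N := by exact_mod_cast hNpos
  have hηε : (N : ℝ) ^ (-1 - δ) = (N : ℝ) ^ (-δ) / N := by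
    rw [show -1 - δ = -δ - 1 by ring, Real.rpow_sub_one hN'.ne']
  have hη : 0 < (N : ℝ) ^ (-1 - δ) := Real.rpow_pos_of_pos hN' _
  have hε0 : 0 < (N : ℝ) ^ (-δ) := Real.rpow_pos_of_pos hN' _
  generalize (N : ℝ) ^ (-1 - δ) = η at *
  generalize (N : ℝ) ^ (-δ) = ε at *
  generalize Real.log N = L at *
  have hL0 : 0 < L := by linarith
  constructor
  · split_ifs with h
    · obtain ⟨i, hi⟩ := h
      rw [hf1 _ (by linarith [half_le_mul_sum_div_sq_add_sq hη (hμ i) hi])]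
    · exact (hf _).1
  · split_ifs with hsmall hlarge hlarge
    · linarith [(hf (η * ∑ i, η / (μ i ^ 2 + η ^ 2))).2]
    · linarith [(hf (η * ∑ i, η / (μ i ^ 2 + η ^ 2))).2]
    · linarith [(hf (η * ∑ i, η / (μ i ^ 2 + η ^ 2))).2]
    · push Not at hsmall hlarge
      have hbound : η * ∑ i, η / (μ i ^ 2 + η ^ 2) ≤ ε ^ 2 + 1 / L ^ 4 :=
        calc η * ∑ i, η / (μ i ^ 2 + η ^ 2)
            ≤ ((η / (L / N)) ^ 2 + 1 / (L ^ 3) ^ 2) *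
                (L / N * ∑ i, (L / N) / (μ i ^ 2 + (L / N) ^ 2)) :=
              mul_sum_div_sq_add_sq_le hη (by positivity) (by positivity) hsmall
          _ ≤ ((η / (L / N)) ^ 2 + 1 / (L ^ 3) ^ 2) * (L / N * (N * L)) := by gcongr
          _ = ε ^ 2 + 1 / L ^ 4 := by
              rw [hηε]
              field_simp
      have hε2 : ε ^ 2 < (1 / 10) ^ 2 := pow_lt_pow_left₀ hε hε0.le two_ne_zero
      have hL4 : 1 / L ^ 4 ≤ 1 / 3 ^ 4 := by gcongr
      rw [hf0 _ (by norm_num at hε2 hL4 hbound ⊢; linarith)]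
      norm_num
end
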